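/- Let Γ be a Bernoulli congestion game with expected demands d_t = ∑_{i: t_i = t} r_i, d_tot ≤ α, and r = max_i r_i < 1. Assume E[|Δ²c_e(1+V)|] ≤ ν for V ~ Poisson(α) and that ĉ_e'(x) ≥ β > 0 on [0, α], where ĉ_e(x) = E[c_e(1 + Poisson(x))]. Let x be the vector of expected loads in any Bayes-Nash equilibrium and x̂ the unique Wardrop equilibrium loads of the nonatomic game with costs ĉ_e and demands d_t. Then ‖x - x̂‖₂ ≤ √(2ακ/β) · √(Λ(r)), where Λ(r) = (αν/2)·r e^r/(1-r)² + ζ r, κ is the cardinality of the largest feasible strategy, and ζ = (e^α - 1)ν + max_e (c_e(2) - c_e(1)). -/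

import Mathlib

open scoped BigOperators Classical

noncomputable def poiPMF (x : ℝ) (k : ℕ) : ℝ := Real.exp (-x) * x ^ k / (Nat.factorial k)

section Defs

variable {E T N : Type*}

noncomputable def bexpVal [Fintype E] [Fintype N] (r : N → ℝ) (σ : N → Finset E → ℝ)
    (g : (N → Bool) → (N → Finset E) → ℝ) : ℝ :=
  ∑ u : N → Bool, ∑ a : N → Finset E,
    (∏ i, (if u i then r i else 1 - r i) * σ i (a i)) * g u a

noncomputable def bload [Fintype E] [Fintype N] (e : E) (u : N → Bool)
    (a : N → Finset E) : ℕ :=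
  ∑ i, if u i ∧ e ∈ a i then 1 else 0

noncomputable def bloadZ [Fintype E] [Fintype N] (i : N) (e : E) (u : N → Bool)
    (a : N → Finset E) : ℕ :=
  ∑ j, if j ≠ i ∧ u j ∧ e ∈ a j then 1 else 0

def IsMixed [Fintype E] (strat : T → Finset (Finset E)) (tm : N → T)
    (σ : N → Finset E → ℝ) : Prop :=
  (∀ i s, 0 ≤ σ i s) ∧ (∀ i s, s ∉ strat (tm i) → σ i s = 0) ∧
  (∀ i, ∑ s ∈ strat (tm i), σ i s = 1)

/-- Bayes–Nash equilibrium of a Bernoulli congestion game. -/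
def IsBNE [Fintype E] [Fintype N] (strat : T → Finset (Finset E)) (c : E → ℕ → ℝ)
    (r : N → ℝ) (tm : N → T) (σ : N → Finset E → ℝ) : Prop :=
  IsMixed strat tm σ ∧
  ∀ i, ∀ s ∈ strat (tm i), ∀ s' ∈ strat (tm i), 0 < σ i s →
    (∑ e ∈ s, bexpVal r σ (fun u a => c e (1 + bloadZ i e u a))) ≤
      ∑ e ∈ s', bexpVal r σ (fun u a => c e (1 + bloadZ i e u a))

/-- The auxiliary cost `ĉ(x) = E[c(1 + X)]`, `X ~ Poisson(x)`. -/
noncomputable def chat (c : ℕ → ℝ) (x : ℝ) : ℝ := ∑' k : ℕ, c (1 + k) * poiPMF x k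

def Feasible [Fintype E] [Fintype T] (strat : T → Finset (Finset E)) (d : T → ℝ)
    (y : T → Finset E → ℝ) (x : E → ℝ) : Prop :=
  (∀ t s, 0 ≤ y t s) ∧ (∀ t s, s ∉ strat t → y t s = 0) ∧
  (∀ t, d t = ∑ s ∈ strat t, y t s) ∧
  (∀ e, x e = ∑ t, ∑ s ∈ strat t, if e ∈ s then y t s else 0)

def IsWE [Fintype E] [Fintype T] (strat : T → Finset (Finset E)) (c : E → ℝ → ℝ)
    (d : T → ℝ) (y : T → Finset E → ℝ) (x : E → ℝ) : Prop :=
  Feasible strat d y x ∧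
  ∀ t, ∀ s ∈ strat t, ∀ s' ∈ strat t, 0 < y t s →
    ∑ e ∈ s, c e (x e) ≤ ∑ e ∈ s', c e (x e)

end Defs


section PoissonExcess

theorem poiPMF_nonneg {x : ℝ} (hx : 0 ≤ x) (k : ℕ) : 0 ≤ poiPMF x k := by
  unfold poiPMF; positivity

theorem poiPMF_le_pow_div {x : ℝ} (hx : 0 ≤ x) (k : ℕ) :
    poiPMF x k ≤ x ^ k / (Nat.factorial k) := by
  unfold poiPMF
  gcongr
  exact mul_le_of_le_one_left (by positivity) (Real.exp_le_one_iff.2 (by linarith))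

theorem hasSum_poiPMF (x : ℝ) : HasSum (poiPMF x) 1 := by
  have h := (NormedSpace.expSeries_div_hasSum_exp (𝔸 := ℝ) x).mul_left (Real.exp (-x))
  rw [← Real.exp_eq_exp_ℝ, ← Real.exp_add, neg_add_cancel, Real.exp_zero] at h
  exact (congrArg (HasSum · 1) (funext fun k => by unfold poiPMF; ring)).mp h

theorem hasSum_mul_poiPMF (x : ℝ) : HasSum (fun k : ℕ => (k : ℝ) * poiPMF x k) x := by
  rw [← hasSum_nat_add_iff' 1]
  simp only [Finset.range_one, Finset.sum_singleton, Nat.cast_zero, zero_mul, sub_zero]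
  have h := (hasSum_poiPMF x).mul_left x
  rw [mul_one] at h
  refine (congrArg (HasSum · x) (funext fun k => ?_)).mp h
  unfold poiPMF
  rw [Nat.factorial_succ]
  push_cast
  field_simp
  ring

/-- The expected excess `E[(X - m)₊]` of a variable `X ~ Poisson(x)`, in closed form. -/
noncomputable def poissonExcess : ℕ → ℝ → ℝ
  | 0, x => x
  | m + 1, x => poissonExcess m x - 1 + ∑ k ∈ Finset.range (m + 1), poiPMF x k

theorem hasSum_poissonExcess (m : ℕ) (x : ℝ) :
    HasSum (fun n : ℕ => ((n - m : ℕ) : ℝ) * poiPMF x n) (poissonExcess m x) := by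
  induction m with
  | zero => simpa [poissonExcess] using hasSum_mul_poiPMF x
  | succ m ih =>
    have h1 : HasSum (fun n : ℕ => if n ∈ Finset.range (m + 1) then poiPMF x n else 0)
        (∑ k ∈ Finset.range (m + 1), poiPMF x k) := by
      have : HasSum (fun n : ℕ => if n ∈ Finset.range (m + 1) then poiPMF x n else 0) _ :=
        hasSum_sum_of_ne_finset_zero (s := Finset.range (m + 1)) (fun b hb => if_neg hb)
      rwa [Finset.sum_congr rfl (fun b hb => if_pos hb)] at this
    refine (congrArg (HasSum · _) (funext fun n => ?_)).mp ((ih.sub (hasSum_poiPMF x)).add h1)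
    simp only [Finset.mem_range]
    by_cases h : n < m + 1
    · rw [if_pos h, Nat.sub_eq_zero_of_le (by omega), Nat.sub_eq_zero_of_le (by omega)]
      simp
    · rw [if_neg h, show n - m = (n - (m + 1)) + 1 by omega]
      push_cast
      ring

theorem hasDerivAt_poiPMF_zero (x : ℝ) :
    HasDerivAt (fun x => poiPMF x 0) (-poiPMF x 0) x := by
  have := (hasDerivAt_neg x).exp
  simpa [poiPMF] using this

theorem hasDerivAt_poiPMF_succ (k : ℕ) (x : ℝ) :
    HasDerivAt (fun x => poiPMF x (k + 1)) (poiPMF x k - poiPMF x (k + 1)) x := by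
  have := (((hasDerivAt_neg x).exp.mul (hasDerivAt_pow (k + 1) x)).div_const
    ((Nat.factorial (k + 1) : ℕ) : ℝ))
  refine this.congr_deriv ?_
  unfold poiPMF
  rw [Nat.factorial_succ]
  push_cast
  field_simp
  ring_nf

theorem hasDerivAt_sum_poiPMF (m : ℕ) (x : ℝ) :
    HasDerivAt (fun x => ∑ k ∈ Finset.range (m + 1), poiPMF x k) (-poiPMF x m) x := by
  induction m with
  | zero => simpa using hasDerivAt_poiPMF_zero x
  | succ m ih =>
    simp_rw [Finset.sum_range_succ _ (m + 1)]
    exact (ih.add (hasDerivAt_poiPMF_succ m x)).congr_deriv (by ring)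

theorem hasDerivAt_poissonExcess (m : ℕ) (x : ℝ) :
    HasDerivAt (poissonExcess m) (1 - ∑ k ∈ Finset.range m, poiPMF x k) x := by
  induction m with
  | zero => exact (hasDerivAt_id x).congr_deriv (by simp)
  | succ m ih =>
    have := ((ih.sub_const 1).add (hasDerivAt_sum_poiPMF m x))
    rw [Finset.sum_range_succ]
    exact this.congr_deriv (by ring)

theorem nonneg_of_second_deriv_nonneg {f f' f'' : ℝ → ℝ} (hf : ∀ u, HasDerivAt f (f' u) u)
    (hf' : ∀ u, HasDerivAt f' (f'' u) u) (h0 : f 0 = 0) (h0' : f' 0 = 0) {p : ℝ} (hp : 0 ≤ p)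
    (h : ∀ u ∈ Set.Icc 0 p, 0 ≤ f'' u) : 0 ≤ f p := by
  have key : ∀ {g g' : ℝ → ℝ}, (∀ u, HasDerivAt g (g' u) u) → g 0 = 0 →
      (∀ u ∈ Set.Icc 0 p, 0 ≤ g' u) → ∀ u ∈ Set.Icc 0 p, 0 ≤ g u := by
    intro g g' hg hg0 hg' u hu
    have hm : MonotoneOn g (Set.Icc 0 p) :=
      monotoneOn_of_deriv_nonneg (convex_Icc 0 p)
        (fun v _ => (hg v).continuousAt.continuousWithinAt)
        (fun v _ => (hg v).differentiableAt.differentiableWithinAt)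
        (fun v hv => (hg v).deriv ▸ hg' v (interior_subset hv))
    exact hg0 ▸ hm ⟨le_rfl, hp⟩ hu hu.1
  exact key hf h0 (key hf' h0' h) p ⟨hp, le_rfl⟩

theorem poissonExcess_remainder_le {B B' B'' : ℝ → ℝ} (hB : ∀ u, HasDerivAt B (B' u) u)
    (hB' : ∀ u, HasDerivAt B' (B'' u) u) (h0 : B 0 = 0) (h0' : B' 0 = 0) {p x : ℝ} (hp : 0 ≤ p)
    (j : ℕ) (h : ∀ u ∈ Set.Icc 0 p, poiPMF (x + u) j ≤ B'' u) :
    poissonExcess (j + 1) (x + p) -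
      ((1 - p) * poissonExcess (j + 1) x + p * poissonExcess j x) ≤ B p := by
  have hT : ∀ u, HasDerivAt (fun u => poissonExcess (j + 1) (x + u))
      (1 - ∑ k ∈ Finset.range (j + 1), poiPMF (x + u) k) u := fun u =>
    (hasDerivAt_poissonExcess (j + 1) (x + u)).comp_const_add x u
  have hS : ∀ u, HasDerivAt (fun u => ∑ k ∈ Finset.range (j + 1), poiPMF (x + u) k)
      (-poiPMF (x + u) j) u := fun u =>
    (hasDerivAt_sum_poiPMF j (x + u)).comp_const_add x u
  have := nonneg_of_second_deriv_nonneg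
    (f := fun u => B u - (poissonExcess (j + 1) (x + u) - poissonExcess (j + 1) x -
      u * (1 - ∑ k ∈ Finset.range (j + 1), poiPMF x k)))
    (f' := fun u => B' u - (1 - ∑ k ∈ Finset.range (j + 1), poiPMF (x + u) k -
      (1 - ∑ k ∈ Finset.range (j + 1), poiPMF x k)))
    (f'' := fun u => B'' u - poiPMF (x + u) j)
    (fun u => ((hB u).sub (((hT u).sub_const _).sub
      ((hasDerivAt_id u).mul_const _))).congr_deriv (by ring))
    (fun u => ((hB' u).sub (((hS u).const_sub 1).sub_const _)).congr_deriv (by ring))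
    (by simp [h0]) (by simp [h0']) hp (fun u hu => sub_nonneg.2 (h u hu))
  have e : poissonExcess j x - poissonExcess (j + 1) x
      = 1 - ∑ k ∈ Finset.range (j + 1), poiPMF x k := by
    rw [poissonExcess]; ring
  rw [← e] at this
  linarith

theorem poissonExcess_remainder_nonneg {p x : ℝ} (hp : 0 ≤ p) (hx : 0 ≤ x) (j : ℕ) :
    0 ≤ poissonExcess (j + 1) (x + p) -
      ((1 - p) * poissonExcess (j + 1) x + p * poissonExcess j x) := by
  have hT : ∀ u, HasDerivAt (fun u => poissonExcess (j + 1) (x + u))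
      (1 - ∑ k ∈ Finset.range (j + 1), poiPMF (x + u) k) u := fun u =>
    (hasDerivAt_poissonExcess (j + 1) (x + u)).comp_const_add x u
  have hS : ∀ u, HasDerivAt (fun u => ∑ k ∈ Finset.range (j + 1), poiPMF (x + u) k)
      (-poiPMF (x + u) j) u := fun u =>
    (hasDerivAt_sum_poiPMF j (x + u)).comp_const_add x u
  have := nonneg_of_second_deriv_nonneg
    (f := fun u => (poissonExcess (j + 1) (x + u) - poissonExcess (j + 1) x -
      u * (1 - ∑ k ∈ Finset.range (j + 1), poiPMF x k)))
    (f' := fun u => (1 - ∑ k ∈ Finset.range (j + 1), poiPMF (x + u) k -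
      (1 - ∑ k ∈ Finset.range (j + 1), poiPMF x k)))
    (f'' := fun u => poiPMF (x + u) j)
    (fun u => (((hT u).sub_const _).sub
      ((hasDerivAt_id u).mul_const _)).congr_deriv (by ring))
    (fun u => (((hS u).const_sub 1).sub_const _).congr_deriv (by ring))
    (by simp) (by simp) hp (fun u hu => poiPMF_nonneg (by linarith [hu.1]) j)
  have e : poissonExcess j x - poissonExcess (j + 1) x
      = 1 - ∑ k ∈ Finset.range (j + 1), poiPMF x k := by
    rw [poissonExcess]; ring
  rw [← e] at this
  linarith

theorem poissonExcess_remainder_le_sq {p x K : ℝ} (hp : 0 ≤ p) (j : ℕ)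
    (h : ∀ u ∈ Set.Icc 0 p, poiPMF (x + u) j ≤ K) :
    poissonExcess (j + 1) (x + p) -
      ((1 - p) * poissonExcess (j + 1) x + p * poissonExcess j x) ≤ K * p ^ 2 / 2 :=
  poissonExcess_remainder_le (B := fun u => K * u ^ 2 / 2) (B' := fun u => K * u)
    (B'' := fun _ => K)
    (fun u => (((hasDerivAt_pow 2 u).const_mul K).div_const 2).congr_deriv (by ring))
    (fun u => ((hasDerivAt_id u).const_mul K).congr_deriv (by ring))
    (by simp) (by simp) hp j h

theorem poissonExcess_zero_right (m : ℕ) : poissonExcess m 0 = 0 := by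
  induction m with
  | zero => rfl
  | succ m ih =>
    rw [poissonExcess, ih, Finset.sum_range_succ']
    simp [poiPMF]

theorem poissonExcess_nonneg (m : ℕ) {x : ℝ} (hx : 0 ≤ x) : 0 ≤ poissonExcess m x :=
  (hasSum_poissonExcess m x).nonneg fun n => mul_nonneg (Nat.cast_nonneg _) (poiPMF_nonneg hx n)

theorem poissonExcess_succ_le (j : ℕ) {x : ℝ} (hx : 0 ≤ x) :
    poissonExcess (j + 1) x ≤ x ^ j / Nat.factorial j * x ^ 2 / 2 := by
  have := poissonExcess_remainder_le_sq (x := 0) (K := x ^ j / Nat.factorial j) hx j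
    (fun u hu => by
      rw [zero_add]
      refine (poiPMF_le_pow_div hu.1 j).trans ?_
      have := hu.1
      have := hu.2
      gcongr)
  simpa [poissonExcess_zero_right] using this

theorem poissonExcess_one (x : ℝ) : poissonExcess 1 x = x - 1 + Real.exp (-x) := by
  simp [poissonExcess, poiPMF]

end PoissonExcess

section PoissonBinomial

variable {N : Type*}

/-- Expectation of `h (∑ i ∈ s, B i)` for independent `B i ~ Bernoulli (p i)`. -/
noncomputable def bernExp (p : N → ℝ) (s : Finset N) (h : ℕ → ℝ) : ℝ :=
  ∑ t ∈ s.powerset, ((∏ i ∈ t, p i) * ∏ i ∈ s \ t, (1 - p i)) * h t.card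

theorem bernExp_empty (p : N → ℝ) (h : ℕ → ℝ) : bernExp p ∅ h = h 0 := by
  simp [bernExp]

theorem bernExp_insert (p : N → ℝ) {s : Finset N} {k : N} (hk : k ∉ s) (h : ℕ → ℝ) :
    bernExp p (insert k s) h =
      (1 - p k) * bernExp p s h + p k * bernExp p s (fun n => h (n + 1)) := by
  unfold bernExp
  rw [Finset.sum_powerset_insert hk, Finset.mul_sum, Finset.mul_sum]
  congr 1
  · refine Finset.sum_congr rfl fun t ht => ?_
    have hkt : k ∉ t := fun h' => hk (Finset.mem_powerset.1 ht h')
    rw [Finset.insert_sdiff_of_notMem _ hkt, Finset.prod_insert (by simp [hk])]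
    ring
  · refine Finset.sum_congr rfl fun t ht => ?_
    have hkt : k ∉ t := fun h' => hk (Finset.mem_powerset.1 ht h')
    rw [Finset.prod_insert hkt, Finset.card_insert_of_notMem hkt,
      Finset.insert_sdiff_insert, Finset.sdiff_insert_of_notMem hk]
    ring

theorem bernExp_add (p : N → ℝ) (s : Finset N) (g h : ℕ → ℝ) :
    bernExp p s (fun n => g n + h n) = bernExp p s g + bernExp p s h := by
  simp [bernExp, mul_add, Finset.sum_add_distrib]

theorem bernExp_sub (p : N → ℝ) (s : Finset N) (g h : ℕ → ℝ) :
    bernExp p s (fun n => g n - h n) = bernExp p s g - bernExp p s h := by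
  simp [bernExp, mul_sub, Finset.sum_sub_distrib]

theorem bernExp_const_mul (p : N → ℝ) (s : Finset N) (a : ℝ) (h : ℕ → ℝ) :
    bernExp p s (fun n => a * h n) = a * bernExp p s h := by
  simp only [bernExp, Finset.mul_sum]
  exact Finset.sum_congr rfl fun t _ => by ring

theorem bernExp_sum {ι : Type*} (p : N → ℝ) (s : Finset N) (I : Finset ι) (h : ι → ℕ → ℝ) :
    bernExp p s (fun n => ∑ j ∈ I, h j n) = ∑ j ∈ I, bernExp p s (h j) := by
  simp only [bernExp, Finset.mul_sum]
  exact Finset.sum_comm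

theorem bernExp_congr {p : N → ℝ} {s : Finset N} {g h : ℕ → ℝ} (H : ∀ n ≤ s.card, g n = h n) :
    bernExp p s g = bernExp p s h :=
  Finset.sum_congr rfl fun t ht => by rw [H _ (Finset.card_le_card (Finset.mem_powerset.1 ht))]

theorem bernExp_mono {p : N → ℝ} {s : Finset N} (hp : ∀ i, 0 ≤ p i ∧ p i < 1) {g h : ℕ → ℝ}
    (H : ∀ n, g n ≤ h n) : bernExp p s g ≤ bernExp p s h :=
  Finset.sum_le_sum fun t _ => mul_le_mul_of_nonneg_left (H _) <|
    mul_nonneg (Finset.prod_nonneg fun i _ => (hp i).1)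
      (Finset.prod_nonneg fun i _ => by linarith [(hp i).2])

theorem bernExp_const (p : N → ℝ) (s : Finset N) (a : ℝ) : bernExp p s (fun _ => a) = a := by
  induction s using Finset.induction_on with
  | empty => exact bernExp_empty p _
  | insert k s hk ih => rw [bernExp_insert p hk, ih]; ring

theorem bernExp_id (p : N → ℝ) (s : Finset N) :
    bernExp p s (fun n => (n : ℝ)) = ∑ i ∈ s, p i := by
  induction s using Finset.induction_on with
  | empty => simp [bernExp_empty]
  | insert k s hk ih =>
    rw [bernExp_insert p hk, Finset.sum_insert hk]
    push_cast
    rw [bernExp_add, bernExp_const, ih]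
    ring

/-- The gap between the expected excess over `m` of a Poisson variable and that of a sum of
independent Bernoulli variables with the same mean. -/
noncomputable def excessGap (p : N → ℝ) (m : ℕ) (s : Finset N) : ℝ :=
  poissonExcess m (∑ i ∈ s, p i) - bernExp p s (fun n => ((n - m : ℕ) : ℝ))

/-- The probability that a sum of independent Bernoulli variables is at least `m`. -/
noncomputable def bernTail (p : N → ℝ) (m : ℕ) (s : Finset N) : ℝ :=
  bernExp p s (fun n => if m ≤ n then 1 else 0)

theorem excessGap_zero (p : N → ℝ) (s : Finset N) : excessGap p 0 s = 0 := by
  simp [excessGap, poissonExcess, bernExp_id]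

theorem excessGap_empty (p : N → ℝ) (m : ℕ) : excessGap p m ∅ = 0 := by
  simp [excessGap, poissonExcess_zero_right, bernExp_empty]

theorem excessGap_insert (p : N → ℝ) {s : Finset N} {k : N} (hk : k ∉ s) (j : ℕ) :
    excessGap p (j + 1) (insert k s) =
      (1 - p k) * excessGap p (j + 1) s + p k * excessGap p j s +
        (poissonExcess (j + 1) (∑ i ∈ s, p i + p k) -
          ((1 - p k) * poissonExcess (j + 1) (∑ i ∈ s, p i) +
            p k * poissonExcess j (∑ i ∈ s, p i))) := by
  unfold excessGap
  rw [bernExp_insert p hk, Finset.sum_insert hk, add_comm (p k)]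
  simp only [Nat.add_sub_add_right]
  ring

theorem bernTail_insert (p : N → ℝ) {s : Finset N} {k : N} (hk : k ∉ s) (j : ℕ) :
    bernTail p (j + 1) (insert k s) =
      (1 - p k) * bernTail p (j + 1) s + p k * bernTail p j s := by
  unfold bernTail
  rw [bernExp_insert p hk]
  simp only [Nat.add_le_add_iff_right]

variable {p : N → ℝ}

theorem bernTail_nonneg (hp : ∀ i, 0 ≤ p i ∧ p i < 1) (m : ℕ) (s : Finset N) :
    0 ≤ bernTail p m s := by
  rw [← bernExp_const p s 0]
  exact bernExp_mono hp fun n => by split_ifs <;> norm_num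

theorem bernTail_le_one (hp : ∀ i, 0 ≤ p i ∧ p i < 1) (m : ℕ) (s : Finset N) :
    bernTail p m s ≤ 1 := by
  rw [← bernExp_const p s 1]
  exact bernExp_mono hp fun n => by split_ifs <;> norm_num

theorem bernTail_succ_le (hp : ∀ i, 0 ≤ p i ∧ p i < 1) (m : ℕ) (s : Finset N) :
    bernTail p (m + 1) s ≤ bernTail p m s :=
  bernExp_mono hp fun n => by split_ifs <;> first | omega | norm_num

theorem bernTail_le_insert (hp : ∀ i, 0 ≤ p i ∧ p i < 1) (m : ℕ) (s : Finset N) (k : N) :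
    bernTail p m s ≤ bernTail p m (insert k s) := by
  by_cases hk : k ∈ s
  · rw [Finset.insert_eq_of_mem hk]
  cases m with
  | zero => simp [bernTail, bernExp_const]
  | succ j =>
    rw [bernTail_insert p hk]
    nlinarith [bernTail_succ_le hp j s, (hp k).1]

theorem pow_add_mul_pow_le {x q : ℝ} (hx : 0 ≤ x) (hq : 0 ≤ q) (j : ℕ) :
    x ^ (j + 1) / Nat.factorial (j + 1) + q * (x ^ j / Nat.factorial j) ≤
      (x + q) ^ (j + 1) / Nat.factorial (j + 1) := by
  have h : x ^ (j + 1) + (j + 1) * q * x ^ j ≤ (x + q) ^ (j + 1) := by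
    induction j with
    | zero => simp
    | succ j ih =>
      calc x ^ (j + 1 + 1) + ((j + 1 : ℕ) + 1) * q * x ^ (j + 1)
          ≤ (x ^ (j + 1) + (j + 1) * q * x ^ j) * (x + q) := by
            have : 0 ≤ (j + 1) * q * x ^ j * q := by positivity
            push_cast
            linear_combination this
        _ ≤ (x + q) ^ (j + 1) * (x + q) := by gcongr
        _ = _ := by ring
  rw [Nat.factorial_succ]
  push_cast
  have hf : (0 : ℝ) < Nat.factorial j := by positivity
  have hj : (0 : ℝ) < j + 1 := by positivity
  rw [show x ^ (j + 1) / ((j + 1) * (Nat.factorial j : ℝ)) + q * (x ^ j / Nat.factorial j)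
    = (x ^ (j + 1) + (j + 1) * q * x ^ j) / ((j + 1) * Nat.factorial j) by field_simp]
  gcongr

theorem bernTail_le_pow_div (hp : ∀ i, 0 ≤ p i ∧ p i < 1) (m : ℕ) (s : Finset N) :
    bernTail p m s ≤ (∑ i ∈ s, p i) ^ m / Nat.factorial m := by
  induction s using Finset.induction_on generalizing m with
  | empty =>
    cases m with
    | zero => simpa using bernTail_le_one hp 0 ∅
    | succ m => simp [bernTail, bernExp_empty]
  | insert k s hk ih =>
    cases m with
    | zero => simpa using bernTail_le_one hp 0 (insert k s)
    | succ j =>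
      rw [bernTail_insert p hk, Finset.sum_insert hk, add_comm (p k)]
      refine le_trans ?_ (pow_add_mul_pow_le (Finset.sum_nonneg fun i _ => (hp i).1) (hp k).1 j)
      have h1 := ih (j + 1)
      have h2 := mul_le_mul_of_nonneg_left (ih j) (hp k).1
      nlinarith [bernTail_nonneg hp (j + 1) s, (hp k).1]

theorem excessGap_nonneg (hp : ∀ i, 0 ≤ p i ∧ p i < 1) (m : ℕ) (s : Finset N) :
    0 ≤ excessGap p m s := by
  induction s using Finset.induction_on generalizing m with
  | empty => rw [excessGap_empty]
  | insert k s hk ih =>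
    cases m with
    | zero => rw [excessGap_zero]
    | succ j =>
      rw [excessGap_insert p hk]
      have h1 := mul_nonneg (sub_nonneg.2 (hp k).2.le) (ih (j + 1))
      have h2 := mul_nonneg (hp k).1 (ih j)
      have h3 := poissonExcess_remainder_nonneg (hp k).1
        (Finset.sum_nonneg fun i _ => (hp i).1 : 0 ≤ ∑ i ∈ s, p i) j
      linarith

theorem excessGap_le_mul_pow (hp : ∀ i, 0 ≤ p i ∧ p i < 1) {ρ : ℝ} (hρ : ∀ i, p i ≤ ρ)
    (j : ℕ) (s : Finset N) :
    excessGap p (j + 1) s ≤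
      ρ / 2 * ((∑ i ∈ s, p i) * ((∑ i ∈ s, p i) ^ j / Nat.factorial j)) := by
  induction s using Finset.induction_on generalizing j with
  | empty => simp [excessGap_empty]
  | insert k s hk ih =>
    rw [excessGap_insert p hk, Finset.sum_insert hk, add_comm (p k)]
    have hx : 0 ≤ ∑ i ∈ s, p i := Finset.sum_nonneg fun i _ => (hp i).1
    set x := ∑ i ∈ s, p i
    have hq := (hp k).1
    have hqρ := hρ k
    have hq1 := (hp k).2
    set q := p k
    have hR := poissonExcess_remainder_le_sq (x := x) (K := (x + q) ^ j / Nat.factorial j) hq j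
      (fun u hu => by
        have := hu.1
        have := hu.2
        refine (poiPMF_le_pow_div (by linarith) j).trans ?_
        gcongr)
    have hA : 0 ≤ (x + q) ^ j / (Nat.factorial j : ℝ) := by positivity
    have hR' : (x + q) ^ j / Nat.factorial j * q ^ 2 / 2 ≤
        ρ / 2 * (q * ((x + q) ^ j / Nat.factorial j)) := by
      nlinarith [mul_nonneg hA (mul_nonneg hq (sub_nonneg.2 hqρ))]
    have h1 : (1 - q) * excessGap p (j + 1) s ≤ ρ / 2 * (x * (x ^ j / Nat.factorial j)) := by
      nlinarith [ih j, excessGap_nonneg hp (j + 1) s]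
    have hρ0 : 0 ≤ ρ / 2 := by linarith
    cases j with
    | zero =>
      rw [excessGap_zero]
      simp only [pow_zero, Nat.factorial_zero, Nat.cast_one, div_one] at *
      nlinarith
    | succ j =>
      have h2 := mul_le_mul_of_nonneg_left (ih j) hq
      have h3 := mul_le_mul_of_nonneg_left
        (mul_le_mul_of_nonneg_left (pow_add_mul_pow_le hx hq j) hx) hρ0
      nlinarith

theorem excessGap_one (p : N → ℝ) (s : Finset N) :
    excessGap p 1 s = Real.exp (-∑ i ∈ s, p i) - 1 + bernTail p 1 s := by
  have h : bernExp p s (fun n => ((n - 1 : ℕ) : ℝ)) = ∑ i ∈ s, p i - bernTail p 1 s := by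
    rw [← bernExp_id, bernTail, ← bernExp_sub]
    congr 1
    funext n
    cases n <;> simp
  rw [excessGap, h, poissonExcess_one]
  ring

theorem excessGap_one_le (hp : ∀ i, 0 ≤ p i ∧ p i < 1) {C : ℝ}
    (hC : ∀ i, 1 - (1 - p i) * Real.exp (p i) ≤ C * p i) (s : Finset N) :
    excessGap p 1 s ≤ C * ((∑ i ∈ s, p i) * Real.exp (-∑ i ∈ s, p i)) := by
  induction s using Finset.induction_on with
  | empty => simp [excessGap_empty]
  | insert k s hk ih =>
    have hq := (hp k).1
    have e := excessGap_insert p hk 0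
    simp only [zero_add, excessGap_zero, poissonExcess_one] at e
    rw [e, Finset.sum_insert hk, add_comm (p k), neg_add, Real.exp_add]
    simp only [poissonExcess]
    have h0 := excessGap_nonneg hp 1 s
    set x := ∑ i ∈ s, p i
    have hE := Real.exp_pos (-x)
    have hq' := Real.add_one_le_exp (-p k)
    have hF := Real.exp_pos (-p k)
    have h1 : (1 - p k) * excessGap p 1 s ≤
        Real.exp (-p k) * (C * (x * Real.exp (-x))) := by
      have := (hp k).2
      gcongr
      linarith
    have h2 : Real.exp (-p k) - (1 - p k) ≤ C * p k * Real.exp (-p k) := by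
      have := mul_le_mul_of_nonneg_right (hC k) hF.le
      rw [sub_mul, mul_assoc, ← Real.exp_add] at this
      simpa using this
    have h3 := mul_le_mul_of_nonneg_left h2 hE.le
    nlinarith

theorem pow_mul_sub_le {s u : ℝ} (hu : 0 ≤ u) (hus : u ≤ s) (n : ℕ) :
    s ^ n * (s - (n + 1) * u) ≤ (s - u) ^ (n + 1) := by
  induction n with
  | zero => simp
  | succ n ih =>
    have h := mul_le_mul_of_nonneg_right ih (sub_nonneg.2 hus)
    have : 0 ≤ s ^ n * ((n + 1) * u ^ 2) := by
      have := hu.trans hus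
      positivity
    rw [← pow_succ] at h
    push_cast
    linear_combination h + this

theorem sq_mul_exp_neg_le {s : ℝ} (hs : 0 ≤ s) : s ^ 2 * Real.exp (-s) ≤ 3 / 4 := by
  have h1 := Real.add_one_le_exp (s / 2 - 1)
  have h2 : Real.exp s = Real.exp 1 ^ 2 * Real.exp (s / 2 - 1) ^ 2 := by
    rw [← Real.exp_nat_mul, ← Real.exp_nat_mul, ← Real.exp_add]
    congr 1
    push_cast
    ring
  have he := Real.exp_one_gt_d9
  rw [Real.exp_neg, ← div_eq_mul_inv, div_le_iff₀ (Real.exp_pos s), h2]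
  have h3 : (s / 2) ^ 2 ≤ Real.exp (s / 2 - 1) ^ 2 := by gcongr; linarith
  have h4 : (2.7 : ℝ) ^ 2 ≤ Real.exp 1 ^ 2 := by gcongr; linarith
  nlinarith [sq_nonneg s, mul_le_mul h4 h3 (by positivity) (by positivity)]

theorem exp_neg_mul_pow_le {s u q : ℝ} (hu : 0 ≤ u) (hus : u ≤ s) (huq : u ≤ q) (hq : q ≤ 1)
    (i : ℕ) :
    Real.exp (-s) * s ^ (i + 2) ≤ q / 2 * ((i + 2) * (i + 1) * s ^ i) + (s - u) ^ (i + 2) := by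
  have hs := hu.trans hus
  have hE := Real.exp_pos (-s)
  have hE1 : Real.exp (-s) ≤ 1 := Real.exp_le_one_iff.2 (by linarith)
  rcases i.eq_zero_or_pos with rfl | hi
  · norm_num
    rcases le_or_gt s (1 / 2) with h | h
    · nlinarith [sq_nonneg s, mul_nonneg hu (by linarith : 0 ≤ 1 - 2 * s), sq_nonneg u]
    · have h1 : Real.exp (-s) * s ^ 2 ≤ s - 1 / 4 := by
        rw [Real.exp_neg, inv_mul_le_iff₀ (Real.exp_pos s)]
        nlinarith [Real.add_one_le_exp s]
      nlinarith [sq_nonneg (s - u - 1 / 2)]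
  · have h1 := pow_mul_sub_le hu hus (i + 1)
    have hi' : (1 : ℝ) ≤ i := by exact_mod_cast hi
    have h2 : s ^ 2 * Real.exp (-s) ≤ u / 2 * ((i + 2) * (i + 1)) + s * (s - (i + 2) * u) := by
      rcases le_or_gt s ((i + 1) / 2) with h | h
      · have := mul_nonneg (mul_nonneg hu (by linarith : (0 : ℝ) ≤ i + 2))
          (by linarith : 0 ≤ (i + 1) / 2 - s)
        nlinarith [sq_nonneg s]
      · have := mul_nonneg (mul_nonneg (by linarith : (0 : ℝ) ≤ 1 - u)
          (by linarith : (0 : ℝ) ≤ i + 2)) (by linarith : 0 ≤ s - (i + 1) / 2)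
        nlinarith [sq_mul_exp_neg_le hs, sq_nonneg (s - (i + 2) / 2)]
    have h3 := mul_le_mul_of_nonneg_left h2 (pow_nonneg hs i)
    have h4 : u / 2 * ((i + 2) * (i + 1) * s ^ i) ≤ q / 2 * ((i + 2) * (i + 1) * s ^ i) := by
      gcongr
    push_cast at h1
    linear_combination h1 + h3 + h4

theorem poissonExcess_remainder_le_pow {x q : ℝ} (hx : 0 ≤ x) (hq : 0 ≤ q) (hq1 : q ≤ 1)
    (i : ℕ) :
    poissonExcess (i + 2 + 1) (x + q) -
      ((1 - q) * poissonExcess (i + 2 + 1) x + q * poissonExcess (i + 2) x) ≤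
    q / 2 * ((x + q) ^ (i + 2) / Nat.factorial (i + 2) -
      (1 - q) * (x ^ (i + 2) / Nat.factorial (i + 2)) -
      q * (x ^ (i + 1) / Nat.factorial (i + 1))) := by
  have hd : ∀ (n : ℕ) (u : ℝ), HasDerivAt (fun u => (x + u) ^ (n + 1) / (Nat.factorial (n + 1) : ℝ))
      ((x + u) ^ n / Nat.factorial n) u := fun n u => by
    refine ((((hasDerivAt_id u).const_add x).pow (n + 1)).div_const _).congr_deriv ?_
    rw [Nat.factorial_succ]
    push_cast
    field_simp
    simp
  refine (poissonExcess_remainder_le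
    (B := fun u => q / 2 * ((x + u) ^ (i + 2) / Nat.factorial (i + 2) -
        x ^ (i + 2) / Nat.factorial (i + 2) - u * (x ^ (i + 1) / Nat.factorial (i + 1))) +
      x ^ (i + 2) / Nat.factorial (i + 2) * u ^ 2 / 2)
    (B' := fun u => q / 2 * ((x + u) ^ (i + 1) / Nat.factorial (i + 1) -
        x ^ (i + 1) / Nat.factorial (i + 1)) + x ^ (i + 2) / Nat.factorial (i + 2) * u)
    (B'' := fun u => q / 2 * ((x + u) ^ i / Nat.factorial i) +
      x ^ (i + 2) / Nat.factorial (i + 2))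
    (fun u => ?_) (fun u => ?_) (by simp) (by simp) hq (i + 2) (fun u hu => ?_)).trans
    (le_of_eq (by ring))
  · exact (((((hd (i + 1) u).sub_const _).sub ((hasDerivAt_id u).mul_const _)).const_mul _).add
      (((hasDerivAt_pow 2 u).const_mul _).div_const 2)).congr_deriv (by ring)
  · exact ((((hd i u).sub_const _).const_mul _).add
      ((hasDerivAt_id u).const_mul _)).congr_deriv (by ring)
  · have h := exp_neg_mul_pow_le hu.1 (le_add_of_nonneg_left hx) hu.2 hq1 i
    rw [add_sub_cancel_right] at h
    have hf : (Nat.factorial (i + 2) : ℝ) = (i + 2) * (i + 1) * Nat.factorial i := by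
      rw [Nat.factorial_succ, Nat.factorial_succ]
      push_cast
      ring
    have hf0 : (0 : ℝ) < Nat.factorial i := by positivity
    unfold poiPMF
    rw [show q / 2 * ((x + u) ^ i / (Nat.factorial i : ℝ)) + x ^ (i + 2) / Nat.factorial (i + 2)
      = (q / 2 * ((i + 2) * (i + 1) * (x + u) ^ i) + x ^ (i + 2)) / Nat.factorial (i + 2) by
        rw [hf]; field_simp]
    gcongr

theorem excessGap_succ_le_pow (hp : ∀ i, 0 ≤ p i ∧ p i < 1) {ρ : ℝ} (hρ : ∀ i, p i ≤ ρ)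
    {j : ℕ} (hj : 1 ≤ j) (s : Finset N) :
    excessGap p (j + 1) s ≤ ρ / 2 * ((∑ i ∈ s, p i) ^ j / Nat.factorial j) := by
  induction s using Finset.induction_on generalizing j with
  | empty => rw [excessGap_empty, Finset.sum_empty, zero_pow (by omega)]; simp
  | insert k s hk ih =>
    have hD1 := excessGap_le_mul_pow hp hρ 0 s
    rw [excessGap_insert p hk, Finset.sum_insert hk, add_comm (p k)]
    have hx : 0 ≤ ∑ i ∈ s, p i := Finset.sum_nonneg fun i _ => (hp i).1
    have hq := (hp k).1
    have hqρ := hρ k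
    have hq1 := (hp k).2
    set x := ∑ i ∈ s, p i
    set q := p k
    have h1 := mul_le_mul_of_nonneg_left (ih hj) (sub_nonneg.2 hq1.le)
    match j, hj with
    | 1, _ =>
      have hR := poissonExcess_remainder_le_sq (x := x) (K := 1) hq 1 fun u hu => by
        have h0 : 0 ≤ x + u := add_nonneg hx hu.1
        have hs := hasSum_poiPMF (x + u)
        exact hs.tsum_eq ▸ hs.summable.le_tsum 1 fun n _ => poiPMF_nonneg h0 n
      simp only [pow_zero, pow_one, Nat.factorial_zero, Nat.factorial_one, Nat.cast_one, div_one,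
        mul_one, zero_add] at *
      have h2 := mul_le_mul_of_nonneg_left hD1 hq
      nlinarith [mul_nonneg hq (sub_nonneg.2 hqρ)]
    | i + 2, _ =>
      have h2 := mul_le_mul_of_nonneg_left (ih (j := i + 1) (by omega)) hq
      have hR := poissonExcess_remainder_le_pow hx hq hq1.le i
      have hB := pow_add_mul_pow_le hx hq (i + 1)
      have hA : 0 ≤ x ^ (i + 2) / (Nat.factorial (i + 2) : ℝ) := by positivity
      have hM : 0 ≤ (x + q) ^ (i + 2) / (Nat.factorial (i + 2) : ℝ) -
          (1 - q) * (x ^ (i + 2) / Nat.factorial (i + 2)) -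
          q * (x ^ (i + 1) / Nat.factorial (i + 1)) := by
        have := mul_nonneg hq hA
        simp only [add_assoc, Nat.reduceAdd] at hB
        linarith
      have h3 := mul_le_mul_of_nonneg_right (by linarith : q / 2 ≤ ρ / 2) hM
      simp only [add_assoc, Nat.reduceAdd] at *
      linarith

end PoissonBinomial

section Constants

variable {N : Type*}

theorem mul_exp_neg_le_exp_neg_one (x : ℝ) : x * Real.exp (-x) ≤ Real.exp (-1) := by
  rw [show Real.exp (-1) = Real.exp (x - 1) * Real.exp (-x) by rw [← Real.exp_add]; ring_nf]
  gcongr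
  linarith [Real.add_one_le_exp (x - 1)]

theorem mul_exp_neg_le_of_le_one {x a : ℝ} (hxa : x ≤ a) (ha0 : 0 ≤ a) (ha : a ≤ 1) :
    x * Real.exp (-x) ≤ a * Real.exp (-a) := by
  rw [show Real.exp (-a) = Real.exp (x - a) * Real.exp (-x) by rw [← Real.exp_add]; ring_nf,
    ← mul_assoc]
  gcongr
  nlinarith [Real.add_one_le_exp (x - a)]

theorem sub_one_mul_exp_neg_le {x a : ℝ} (hxa : x ≤ a) (ha : a ≤ 2) :
    (x - 1) * Real.exp (-x) ≤ (a - 1) * Real.exp (-a) := by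
  rw [show Real.exp (-a) = Real.exp (x - a) * Real.exp (-x) by rw [← Real.exp_add]; ring_nf,
    ← mul_assoc]
  gcongr
  have h1 := Real.add_one_le_exp (x - a)
  have h2 : Real.exp (x - a) ≤ 1 := Real.exp_le_one_iff.2 (by linarith)
  rcases le_total 1 a with h | h <;> nlinarith

theorem exp_neg_one_le_two_mul {a : ℝ} (h1 : 3 / 4 ≤ a) (h2 : a ≤ 2) :
    Real.exp (-1) ≤ 2 * (a * Real.exp (-a)) := by
  rw [show Real.exp (-1) = Real.exp (a - 1) * Real.exp (-a) by rw [← Real.exp_add]; ring_nf,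
    ← mul_assoc]
  gcongr
  have := Real.abs_exp_sub_one_sub_id_le (x := a - 1) (by rw [abs_le]; constructor <;> linarith)
  rw [abs_le] at this
  nlinarith [this.2]

theorem one_sub_mul_exp_le_sq {q : ℝ} (hq1 : q < 1) :
    1 - (1 - q) * Real.exp q ≤ q ^ 2 := by
  nlinarith [Real.add_one_le_exp q]

theorem one_sub_mul_exp_le_sq_mul_exp {q : ℝ} (hq : 0 ≤ q) :
    1 - (1 - q) * Real.exp q ≤ q ^ 2 * Real.exp q / 2 := by
  have h := Real.quadratic_le_exp_of_nonneg hq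
  have h1 : 1 ≤ (1 - q + q ^ 2 / 2) * Real.exp q := by
    have : 0 ≤ 1 - q + q ^ 2 / 2 := by nlinarith [sq_nonneg (q - 1)]
    nlinarith [mul_le_mul_of_nonneg_left h this, sq_nonneg (q ^ 2)]
  linarith

/-- Simultaneous bounds for the Poisson approximation error of the elementary convex costs and for
the effect of removing one player, with the two constants adding up as the estimate needs. -/
theorem exists_excessGap_bounds {α ρ : ℝ} (hα : 0 < α) (hρ0 : 0 ≤ ρ) (hρ1 : ρ < 1) :
    ∃ U W : ℝ, 0 ≤ W ∧ 0 ≤ U ∧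
      U + W ≤ α * (ρ * Real.exp ρ / (1 - ρ) ^ 2) + 2 * (Real.exp α - 1) * ρ ∧
      ∀ (p : N → ℝ) (s : Finset N), (∀ i, 0 ≤ p i ∧ p i ≤ ρ) → ∑ i ∈ s, p i ≤ α →
        ∀ j, excessGap p (j + 1) s ≤ W * poiPMF α j ∧
          excessGap p (j + 1) s + ρ * bernTail p (j + 1) s ≤ U * poiPMF α j := by
  set R := ρ * Real.exp ρ / (1 - ρ) ^ 2 with hR
  have hd : 0 < (1 - ρ) ^ 2 := by have : 0 < 1 - ρ := by linarith
                                  positivity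
  have hR1 : ρ * Real.exp ρ ≤ R := by
    rw [hR, le_div_iff₀ hd]
    exact mul_le_of_le_one_right (by positivity) (by nlinarith)
  have hR2 : ρ * (1 + 2 * ρ) ≤ R := by
    rw [hR, mul_div_assoc]
    gcongr
    rw [le_div_iff₀ hd]
    have h1 : (1 + 2 * ρ) * (1 - ρ) ^ 2 ≤ 1 + ρ := by
      nlinarith [mul_nonneg hρ0 hρ0, mul_nonneg (mul_nonneg hρ0 hρ0) hρ0,
        mul_nonneg hρ0 (sub_nonneg.2 hρ1.le)]
    linarith [Real.add_one_le_exp ρ]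
  have hR3 : ρ ≤ R := by nlinarith
  set E := Real.exp (-α) with hE
  have hE0 : 0 < E := Real.exp_pos _
  have hE1 : E ≤ 1 := Real.exp_le_one_iff.2 (by linarith)
  have hEE : Real.exp α * E = 1 := by rw [hE, ← Real.exp_add]; simp
  have hpmf : ∀ j, poiPMF α j = E * (α ^ j / Nat.factorial j) := fun j => by
    rw [poiPMF, mul_div_assoc]
  suffices H : ∃ U W : ℝ, 0 ≤ W ∧ 0 ≤ U ∧
      U + W ≤ α * E * R + 2 * (1 - E) * ρ ∧
      ∀ (p : N → ℝ) (s : Finset N), (∀ i, 0 ≤ p i ∧ p i ≤ ρ) → ∑ i ∈ s, p i ≤ α →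
        ∀ j, excessGap p (j + 1) s ≤ W * (α ^ j / Nat.factorial j) ∧
          excessGap p (j + 1) s + ρ * bernTail p (j + 1) s ≤ U * (α ^ j / Nat.factorial j) by
    obtain ⟨U, W, hW, hU, hs, hb⟩ := H
    refine ⟨Real.exp α * U, Real.exp α * W, by positivity, by positivity, ?_, ?_⟩
    · have := mul_le_mul_of_nonneg_left hs (Real.exp_pos α).le
      linear_combination this + (α * R - 2 * ρ) * hEE
    · intro p s hp hx j
      rw [hpmf, show ∀ V, Real.exp α * V * (E * (α ^ j / (Nat.factorial j : ℝ)))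
        = Real.exp α * E * (V * (α ^ j / Nat.factorial j)) from fun V => by ring, hEE, one_mul,
        show ∀ V, Real.exp α * V * (E * (α ^ j / (Nat.factorial j : ℝ)))
        = Real.exp α * E * (V * (α ^ j / Nat.factorial j)) from fun V => by ring, hEE, one_mul]
      exact hb p s hp hx j
  have hq : ∀ j : ℕ, 0 ≤ α ^ j / (Nat.factorial j : ℝ) := fun j => by positivity
  have hgap1 : ∀ (p : N → ℝ) (s : Finset N), (∀ i, 0 ≤ p i ∧ p i ≤ ρ) →
      excessGap p 1 s ≤ ρ * ((∑ i ∈ s, p i) * Real.exp (-∑ i ∈ s, p i)) := fun p s hp =>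
    excessGap_one_le (fun i => ⟨(hp i).1, (hp i).2.trans_lt hρ1⟩) (fun i =>
      (one_sub_mul_exp_le_sq ((hp i).2.trans_lt hρ1)).trans (by nlinarith [(hp i).1, (hp i).2])) s
  have hgapR : ∀ (p : N → ℝ) (s : Finset N), (∀ i, 0 ≤ p i ∧ p i ≤ ρ) →
      excessGap p 1 s ≤ R / 2 * ((∑ i ∈ s, p i) * Real.exp (-∑ i ∈ s, p i)) := fun p s hp =>
    excessGap_one_le (fun i => ⟨(hp i).1, (hp i).2.trans_lt hρ1⟩) (fun i => by
      refine (one_sub_mul_exp_le_sq_mul_exp (hp i).1).trans ?_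
      have h0 := (hp i).1
      have h1 : p i * Real.exp (p i) ≤ ρ * Real.exp ρ := by
        have := (hp i).2
        gcongr
      nlinarith [mul_le_mul_of_nonneg_left (h1.trans hR1) h0]) s
  have hgap : ∀ (p : N → ℝ) (s : Finset N), (∀ i, 0 ≤ p i ∧ p i ≤ ρ) → ∑ i ∈ s, p i ≤ α →
      ∀ j, 1 ≤ j → excessGap p (j + 1) s ≤ ρ / 2 * (α ^ j / Nat.factorial j) := by
    intro p s hp hx j hj
    refine (excessGap_succ_le_pow (fun i => ⟨(hp i).1, (hp i).2.trans_lt hρ1⟩)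
      (fun i => (hp i).2) hj s).trans ?_
    have : 0 ≤ ∑ i ∈ s, p i := Finset.sum_nonneg fun i _ => (hp i).1
    gcongr
  have htail : ∀ (p : N → ℝ) (s : Finset N), (∀ i, 0 ≤ p i ∧ p i ≤ ρ) → ∑ i ∈ s, p i ≤ α →
      ∀ j, 1 ≤ j → bernTail p (j + 1) s ≤ α / 2 * (α ^ j / Nat.factorial j) := by
    intro p s hp hx j hj
    refine (bernTail_le_pow_div (fun i => ⟨(hp i).1, (hp i).2.trans_lt hρ1⟩) (j + 1) s).trans ?_
    have : 0 ≤ ∑ i ∈ s, p i := Finset.sum_nonneg fun i _ => (hp i).1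
    have hj' : (1 : ℝ) ≤ j := by exact_mod_cast hj
    calc (∑ i ∈ s, p i) ^ (j + 1) / (Nat.factorial (j + 1) : ℝ)
        ≤ α ^ (j + 1) / (2 * Nat.factorial j : ℝ) := by
          rw [Nat.factorial_succ]
          push_cast
          gcongr
          linarith
      _ = _ := by
          field_simp
          ring
  have hρE : ρ * E ≤ R * E := by gcongr
  rcases le_total α (3 / 4) with h1 | h1
  · refine ⟨α * E * R / 2 + ρ * α, α * E * R / 2 + ρ * α * (1 - E) / 2, ?_, by positivity, ?_, ?_⟩
    · have := sub_nonneg.2 hE1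
      positivity
    · have h2 := Real.quadratic_le_exp_of_nonneg hα.le
      have h3 : E * (2 - α / 2) ≤ 2 - 3 / 2 * α := by
        have h4 : 2 - α / 2 ≤ (2 - 3 / 2 * α) * Real.exp α := by
          have := mul_le_mul_of_nonneg_left h2 (by linarith : 0 ≤ 2 - 3 / 2 * α)
          nlinarith [mul_nonneg hα.le (by nlinarith : 0 ≤ 1 - α / 2 - 3 / 4 * α ^ 2)]
        have := mul_le_mul_of_nonneg_left h4 hE0.le
        linear_combination this + (2 - 3 / 2 * α) * hEE
      have h4 := mul_le_mul_of_nonneg_left h3 hρ0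
      linear_combination h4
    · intro p s hp hx j
      have hp' : ∀ i, 0 ≤ p i ∧ p i < 1 := fun i => ⟨(hp i).1, (hp i).2.trans_lt hρ1⟩
      have hx0 : 0 ≤ ∑ i ∈ s, p i := Finset.sum_nonneg fun i _ => (hp i).1
      rcases j.eq_zero_or_pos with rfl | hj
      · simp only [zero_add, pow_zero, Nat.factorial_zero, Nat.cast_one, div_one, mul_one]
        have hD := (hgapR p s hp).trans (mul_le_mul_of_nonneg_left
          (mul_exp_neg_le_of_le_one hx hα.le (by linarith)) (by linarith : 0 ≤ R / 2))
        have hT : bernTail p 1 s ≤ α := (by simpa using bernTail_le_pow_div hp' 1 s :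
          bernTail p 1 s ≤ ∑ i ∈ s, p i).trans hx
        have h2 : 0 ≤ ρ * α * (1 - E) / 2 := by
          have := sub_nonneg.2 hE1
          positivity
        exact ⟨by linarith, by nlinarith⟩
      · have hD : excessGap p (j + 1) s ≤ ρ / 2 * α * (α ^ j / Nat.factorial j) := by
          refine (excessGap_le_mul_pow hp' (fun i => (hp i).2) j s).trans ?_
          rw [mul_assoc]
          gcongr
        have hT := mul_le_mul_of_nonneg_left (htail p s hp hx j hj) hρ0
        have h2 : ρ / 2 * α ≤ α * E * R / 2 + ρ * α * (1 - E) / 2 := by nlinarith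
        have h3 : 0 ≤ α * E * R / 2 := by positivity
        exact ⟨hD.trans (mul_le_mul_of_nonneg_right h2 (hq j)),
          by nlinarith [mul_nonneg h3 (hq j)]⟩
  have hEn : Real.exp (-1) ≤ 1 / 2 := by linarith [Real.exp_neg_one_lt_d9]
  have hW : ∀ (p : N → ℝ) (s : Finset N), (∀ i, 0 ≤ p i ∧ p i ≤ ρ) → ∑ i ∈ s, p i ≤ α →
      ∀ j, excessGap p (j + 1) s ≤ ρ / 2 * (α ^ j / Nat.factorial j) := by
    intro p s hp hx j
    rcases j.eq_zero_or_pos with rfl | hj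
    · simp only [zero_add, pow_zero, Nat.factorial_zero, Nat.cast_one, div_one, mul_one]
      nlinarith [hgap1 p s hp, mul_exp_neg_le_exp_neg_one (∑ i ∈ s, p i)]
    · exact hgap p s hp hx j hj
  rcases le_total α 2 with h2 | h2
  · have hE2 : E ≤ 1 / 2 := by
      have := Real.quadratic_le_exp_of_nonneg hα.le
      nlinarith
    have hU : ρ * (3 / 2 + α * E * (1 + 2 * ρ) - 2 * E) ≤
        α * E * R + 2 * (1 - E) * ρ - ρ / 2 := by
      nlinarith [mul_le_mul_of_nonneg_left hR2 (by positivity : 0 ≤ α * E)]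
    have hU1 : ρ * (1 / 2 + α / 2) ≤ α * E * R + 2 * (1 - E) * ρ - ρ / 2 := by
      refine le_trans (mul_le_mul_of_nonneg_left ?_ hρ0) hU
      nlinarith [mul_nonneg (sub_nonneg.2 h2) (sub_nonneg.2 hE2),
        mul_nonneg (mul_nonneg hα.le hE0.le) hρ0]
    refine ⟨α * E * R + 2 * (1 - E) * ρ - ρ / 2, ρ / 2, by positivity,
      le_trans (by positivity) hU1, by linarith, fun p s hp hx j => ⟨hW p s hp hx j, ?_⟩⟩
    rcases j.eq_zero_or_pos with rfl | hj
    · simp only [zero_add, pow_zero, Nat.factorial_zero, Nat.cast_one, div_one, mul_one]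
      refine le_trans ?_ hU
      have hD := hgap1 p s hp
      have hT := excessGap_one p s
      set x := ∑ i ∈ s, p i
      have e1 := sub_one_mul_exp_neg_le hx h2
      have e2 := (mul_exp_neg_le_exp_neg_one x).trans (exp_neg_one_le_two_mul h1 h2)
      rw [← hE] at e1 e2
      have hT' : bernTail p 1 s ≤ 1 - Real.exp (-x) + ρ * (x * Real.exp (-x)) := by linarith
      have e3 := mul_le_mul_of_nonneg_left hT' hρ0
      have e4 := mul_le_mul_of_nonneg_left e1 hρ0
      have e5 := mul_le_mul_of_nonneg_left (mul_le_mul_of_nonneg_left e2 hρ0) hρ0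
      have e6 := mul_le_mul_of_nonneg_left hE2 hρ0
      linear_combination hD + e3 + e4 + e5 + e6
    · have hT := mul_le_mul_of_nonneg_left (htail p s hp hx j hj) hρ0
      refine le_trans ?_ (mul_le_mul_of_nonneg_right hU1 (hq j))
      linear_combination hW p s hp hx j + hT
  · refine ⟨3 / 2 * ρ, ρ / 2, by positivity, by positivity, ?_,
      fun p s hp hx j => ⟨hW p s hp hx j, ?_⟩⟩
    · nlinarith [mul_nonneg (mul_nonneg (sub_nonneg.2 h2) hE0.le) hρ0]
    · have hp' : ∀ i, 0 ≤ p i ∧ p i < 1 := fun i => ⟨(hp i).1, (hp i).2.trans_lt hρ1⟩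
      have hx0 : 0 ≤ ∑ i ∈ s, p i := Finset.sum_nonneg fun i _ => (hp i).1
      have hT : bernTail p (j + 1) s ≤ α ^ j / Nat.factorial j := by
        refine ((bernTail_succ_le hp' j s).trans (bernTail_le_pow_div hp' j s)).trans ?_
        gcongr
      have := mul_le_mul_of_nonneg_left hT hρ0
      linear_combination hW p s hp hx j + this

end Constants

section EdgeBounds

/-- The second difference `c (j + 3) - 2 c (j + 2) + c (j + 1)`. -/
def secondDiff (c : ℕ → ℝ) (j : ℕ) : ℝ := c (j + 3) - 2 * c (j + 2) + c (j + 1)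

theorem succ_sub_eq_sum_secondDiff (c : ℕ → ℝ) {n M : ℕ} (h : n ≤ M) :
    c (1 + (n + 1)) - c (1 + n) =
      (c 2 - c 1) + ∑ j ∈ Finset.range M, secondDiff c j * if j + 1 ≤ n then 1 else 0 := by
  have hr : (Finset.range M).filter (fun j => j + 1 ≤ n) = Finset.range n := by
    ext j
    simp only [Finset.mem_filter, Finset.mem_range]
    omega
  simp only [mul_ite, mul_one, mul_zero]
  rw [← Finset.sum_filter, hr]
  clear h hr
  induction n with
  | zero => simp
  | succ n ih =>
    rw [Finset.sum_range_succ, ← add_assoc (c 2 - c 1), ← ih, secondDiff]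
    ring_nf

theorem eq_add_sum_secondDiff (c : ℕ → ℝ) {n M : ℕ} (h : n ≤ M) :
    c (1 + n) = c 1 + n * (c 2 - c 1) +
      ∑ j ∈ Finset.range M, secondDiff c j * ((n - (j + 1) : ℕ) : ℝ) := by
  induction n with
  | zero => simp
  | succ n ih =>
    have h1 := ih (by omega)
    have h2 := succ_sub_eq_sum_secondDiff c (n := n) (M := M) (by omega)
    have h3 : ∀ j, (((n + 1) - (j + 1) : ℕ) : ℝ) =
        ((n - (j + 1) : ℕ) : ℝ) + if j + 1 ≤ n then 1 else 0 := fun j => by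
      split_ifs with hj
      · rw [show n + 1 - (j + 1) = (n - (j + 1)) + 1 by omega]
        push_cast
        ring
      · rw [show n + 1 - (j + 1) = 0 by omega, show n - (j + 1) = 0 by omega]
        simp
    simp only [h3, mul_add, Finset.sum_add_distrib]
    push_cast
    linarith

theorem hasSum_secondDiff_excess (c : ℕ → ℝ) (n : ℕ) :
    HasSum (fun j => secondDiff c j * ((n - (j + 1) : ℕ) : ℝ))
      (c (1 + n) - c 1 - n * (c 2 - c 1)) := by
  rw [show c (1 + n) - c 1 - n * (c 2 - c 1) =
    ∑ j ∈ Finset.range n, secondDiff c j * ((n - (j + 1) : ℕ) : ℝ) by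
      linarith [eq_add_sum_secondDiff c le_rfl (n := n)]]
  refine hasSum_sum_of_ne_finset_zero fun j hj => ?_
  rw [Finset.mem_range] at hj
  rw [show n - (j + 1) = 0 by omega]
  simp

variable {c : ℕ → ℝ} {α : ℝ}

theorem hasSum_chat (hs : Summable fun j => |secondDiff c j| * poiPMF α j) {x : ℝ} (hx : 0 ≤ x)
    (hxα : x ≤ α) :
    HasSum (fun j => secondDiff c j * poissonExcess (j + 1) x)
      (chat c x - c 1 - x * (c 2 - c 1)) := by
  set F : ℕ × ℕ → ℝ := fun z =>
    secondDiff c z.1 * (((z.2 - (z.1 + 1) : ℕ) : ℝ) * poiPMF x z.2) with hF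
  have hrow : ∀ j, HasSum (fun n => F (j, n)) (secondDiff c j * poissonExcess (j + 1) x) :=
    fun j => (hasSum_poissonExcess (j + 1) x).mul_left _
  have hnorm : ∀ j n, ‖F (j, n)‖ =
      |secondDiff c j| * (((n - (j + 1) : ℕ) : ℝ) * poiPMF x n) := fun j n => by
    rw [hF, norm_mul, Real.norm_eq_abs, Real.norm_of_nonneg
      (mul_nonneg (Nat.cast_nonneg _) (poiPMF_nonneg hx n))]
  have hrown : ∀ j, HasSum (fun n => ‖F (j, n)‖)
      (|secondDiff c j| * poissonExcess (j + 1) x) := fun j => by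
    simp only [hnorm]
    exact (hasSum_poissonExcess (j + 1) x).mul_left _
  have hFs : Summable F := by
    refine Summable.of_norm ((summable_prod_of_nonneg fun z => norm_nonneg _).2
      ⟨fun j => (hrown j).summable, ?_⟩)
    simp only [fun j => (hrown j).tsum_eq]
    refine Summable.of_nonneg_of_le (fun j => mul_nonneg (abs_nonneg _) (poissonExcess_nonneg _ hx))
      (fun j => ?_) (hs.mul_right (Real.exp α * α ^ 2 / 2))
    rw [mul_assoc]
    refine mul_le_mul_of_nonneg_left ((poissonExcess_succ_le j hx).trans ?_) (abs_nonneg _)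
    have : poiPMF α j * (Real.exp α * α ^ 2 / 2) = α ^ j / Nat.factorial j * α ^ 2 / 2 := by
      have h1 : Real.exp (-α) * Real.exp α = 1 := by rw [← Real.exp_add]; simp
      rw [poiPMF]
      linear_combination (α ^ j / Nat.factorial j * α ^ 2 / 2) * h1
    rw [this]
    have := hx.trans hxα
    gcongr
  have h1 := hFs.hasSum.prod_fiberwise hrow
  have h2 := ((Equiv.prodComm ℕ ℕ).hasSum_iff.2 hFs.hasSum).prod_fiberwise
    (g := fun n => (c (1 + n) - c 1 - n * (c 2 - c 1)) * poiPMF x n) fun n => by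
      simpa [hF, mul_assoc] using (hasSum_secondDiff_excess c n).mul_right (poiPMF x n)
  have h3 := (h2.add ((hasSum_poiPMF x).mul_left (c 1))).add
    ((hasSum_mul_poiPMF x).mul_right (c 2 - c 1))
  have h4 : chat c x = (∑' z, F z) + c 1 * 1 + x * (c 2 - c 1) := by
    rw [chat, ← h3.tsum_eq]
    exact tsum_congr fun n => by ring
  convert h1 using 1
  rw [h4]
  ring

variable {N : Type*} {p : N → ℝ}

theorem hasSum_bernExp (p : N → ℝ) (s : Finset N) :
    HasSum (fun j => secondDiff c j * bernExp p s (fun n => ((n - (j + 1) : ℕ) : ℝ)))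
      (bernExp p s (fun n => c (1 + n)) - c 1 - (∑ i ∈ s, p i) * (c 2 - c 1)) := by
  rw [bernExp_congr fun n hn => eq_add_sum_secondDiff c hn, bernExp_add, bernExp_add,
    bernExp_const, bernExp_sum]
  simp only [mul_comm _ (c 2 - c 1), bernExp_const_mul, bernExp_id]
  rw [sub_sub, add_sub_cancel_left]
  refine hasSum_sum_of_ne_finset_zero fun j hj => ?_
  rw [Finset.mem_range] at hj
  rw [bernExp_congr (h := fun _ => 0) fun n hn => by
    rw [show n - (j + 1) = 0 by omega, Nat.cast_zero], bernExp_const, mul_zero]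

theorem hasSum_bernExp_succ_sub (p : N → ℝ) (s : Finset N) :
    HasSum (fun j => secondDiff c j * bernTail p (j + 1) s)
      (bernExp p s (fun n => c (1 + (n + 1)) - c (1 + n)) - (c 2 - c 1)) := by
  rw [bernExp_congr fun n hn => succ_sub_eq_sum_secondDiff c hn, bernExp_add,
    bernExp_const, bernExp_sum, add_sub_cancel_left]
  simp only [bernExp_const_mul]
  refine hasSum_sum_of_ne_finset_zero fun j hj => ?_
  rw [Finset.mem_range] at hj
  rw [bernTail, bernExp_congr (h := fun _ => 0) fun n hn => if_neg (by omega), bernExp_const,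
    mul_zero]

theorem hasSum_excessGap (hs : Summable fun j => |secondDiff c j| * poiPMF α j)
    (hp : ∀ i, 0 ≤ p i) {s : Finset N} (hpα : ∑ i ∈ s, p i ≤ α) :
    HasSum (fun j => secondDiff c j * excessGap p (j + 1) s)
      (chat c (∑ i ∈ s, p i) - bernExp p s (fun n => c (1 + n))) := by
  have h := (hasSum_chat hs (Finset.sum_nonneg fun i _ => hp i) hpα).sub (hasSum_bernExp (c := c) p s)
  simp only [sub_sub_sub_cancel_right, ← mul_sub] at h
  exact h

/-- The auxiliary cost at the expected load differs from the expected cost seen by a player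
who does not count their own participation by a controlled amount. -/
theorem chat_sub_bernExp_bounds (hmono : Monotone c) {ρ ν U W : ℝ}
    (hs : Summable fun j => |secondDiff c j| * poiPMF α j)
    (hν : ∑' j, |secondDiff c j| * poiPMF α j ≤ ν) (hU : 0 ≤ U) (hW : 0 ≤ W)
    (hp : ∀ i, 0 ≤ p i ∧ p i < 1) (hpρ : ∀ i, p i ≤ ρ) {s : Finset N} {k : N} (hk : k ∉ s)
    (hpα : ∑ i ∈ insert k s, p i ≤ α)
    (hb : ∀ j, excessGap p (j + 1) (insert k s) ≤ W * poiPMF α j ∧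
      excessGap p (j + 1) (insert k s) + ρ * bernTail p (j + 1) (insert k s) ≤
        U * poiPMF α j) :
    -(W * ν) ≤ chat c (∑ i ∈ insert k s, p i) - bernExp p s (fun n => c (1 + n)) ∧
      chat c (∑ i ∈ insert k s, p i) - bernExp p s (fun n => c (1 + n)) ≤
        U * ν + ρ * (c 2 - c 1) := by
  have h1 := hasSum_excessGap hs (fun i => (hp i).1) hpα
  have h2 := (hasSum_bernExp_succ_sub (c := c) p s).mul_left (p k)
  have h3 := bernExp_insert p hk fun n => c (1 + n)
  rw [bernExp_sub] at h2
  have h0 : bernExp p s (fun n => c (1 + n)) ≤ bernExp p s (fun n => c (1 + (n + 1))) :=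
    bernExp_mono hp fun n => hmono (by omega)
  have hp0 := (hp k).1
  constructor
  · have h4 := hasSum_le (fun j => ?_) (hs.hasSum.mul_left (-W)) h1
    · nlinarith
    · have := neg_abs_le (secondDiff c j)
      have := (hb j).1
      nlinarith [excessGap_nonneg hp (j + 1) (insert k s), abs_nonneg (secondDiff c j)]
  · have h4 := hasSum_le (fun j => ?_) (h1.add h2) (hs.hasSum.mul_left U)
    · have h5 : p k * (c 2 - c 1) ≤ ρ * (c 2 - c 1) :=
        mul_le_mul_of_nonneg_right (hpρ k) (sub_nonneg.2 (hmono (by norm_num)))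
      nlinarith
    · have h5 := le_abs_self (secondDiff c j)
      have h6 := excessGap_nonneg hp (j + 1) (insert k s)
      have h7 := bernTail_nonneg hp (j + 1) s
      have h8 : p k * bernTail p (j + 1) s ≤ ρ * bernTail p (j + 1) (insert k s) :=
        mul_le_mul (hpρ k) (bernTail_le_insert hp (j + 1) s k) h7 (hp0.trans (hpρ k))
      calc secondDiff c j * excessGap p (j + 1) (insert k s) +
            p k * (secondDiff c j * bernTail p (j + 1) s)
          = secondDiff c j * (excessGap p (j + 1) (insert k s) + p k * bernTail p (j + 1) s) := by
            ring
        _ ≤ |secondDiff c j| * (U * poiPMF α j) :=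
            mul_le_mul h5 (by linarith [(hb j).2]) (by positivity) (abs_nonneg _)
        _ = _ := by ring

end EdgeBounds

section Game

variable {E T N : Type*} [Fintype E]

/-- The probability that player `i` is active and uses the resource `e`. -/
noncomputable def useProb (r : N → ℝ) (σ : N → Finset E → ℝ) (e : E) (i : N) : ℝ :=
  r i * ∑ s, if e ∈ s then σ i s else 0

variable {r : N → ℝ} {σ : N → Finset E → ℝ}

section Fintype

variable [Fintype N]

theorem sum_sum_prod_eq_prod_sum_sum {A B : Type*} [Fintype A] [Fintype B]
    (f : N → A → B → ℝ) :
    ∑ u : N → A, ∑ a : N → B, ∏ i, f i (u i) (a i) = ∏ i, ∑ b, ∑ s, f i b s := by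
  rw [Finset.prod_univ_sum, Fintype.piFinset_univ]
  refine Finset.sum_congr rfl fun u _ => ?_
  rw [Finset.prod_univ_sum, Fintype.piFinset_univ]

theorem bexpVal_card_filter (hσ : ∀ i, ∑ a, σ i a = 1) (e : E) (s : Finset N) (h : ℕ → ℝ) :
    bexpVal r σ (fun u a => h (s.filter fun i => u i ∧ e ∈ a i).card) =
      bernExp (useProb r σ e) s h := by
  have hone : ∀ t ⊆ s, ∀ (u : N → Bool) (a : N → Finset E),
      (if s.filter (fun i => u i ∧ e ∈ a i) = t then (1 : ℝ) else 0) =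
        ∏ i, if i ∈ s then (if (i ∈ t ↔ (u i ∧ e ∈ a i)) then 1 else 0) else 1 := by
    intro t ht u a
    split_ifs with hA
    · refine (Finset.prod_eq_one fun i _ => ?_).symm
      subst hA
      by_cases hi : i ∈ s <;> simp [hi]
    · have : ∃ i ∈ s, ¬(i ∈ t ↔ (u i ∧ e ∈ a i)) := by
        by_contra! H
        refine hA (Finset.ext fun i => ?_)
        rw [Finset.mem_filter]
        exact ⟨fun hi => (H i hi.1).2 hi.2, fun hi => ⟨ht hi, (H i (ht hi)).1 hi⟩⟩
      obtain ⟨i, hi, hne⟩ := this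
      exact (Finset.prod_eq_zero (Finset.mem_univ i) (by rw [if_pos hi, if_neg hne])).symm
  have hkey : ∀ t ⊆ s, ∑ u : N → Bool, ∑ a : N → Finset E,
      (∏ i, (if u i then r i else 1 - r i) * σ i (a i)) *
        (if s.filter (fun i => u i ∧ e ∈ a i) = t then (1 : ℝ) else 0) =
      (∏ i ∈ t, useProb r σ e i) * ∏ i ∈ s \ t, (1 - useProb r σ e i) := by
    intro t ht
    simp only [hone t ht, ← Finset.prod_mul_distrib]
    rw [sum_sum_prod_eq_prod_sum_sum (fun i (b : Bool) (x : Finset E) =>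
      (if b then r i else 1 - r i) * σ i x *
        if i ∈ s then (if (i ∈ t ↔ (b ∧ e ∈ x)) then 1 else 0) else 1)]
    have hfac : ∀ i, (∑ b : Bool, ∑ x : Finset E, (if b then r i else 1 - r i) * σ i x *
        if i ∈ s then (if (i ∈ t ↔ (b ∧ e ∈ x)) then 1 else 0) else 1) =
        if i ∈ s then (if i ∈ t then useProb r σ e i else 1 - useProb r σ e i) else 1 := by
      intro i
      have huse : ∑ x, (if e ∈ x then r i * σ i x else 0) = useProb r σ e i := by
        simp only [useProb, Finset.mul_sum, mul_ite, mul_zero]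
      have hnot : ∑ x, (if e ∈ x then 0 else r i * σ i x) = r i - useProb r σ e i := by
        have htot : ∑ x, r i * σ i x = r i := by rw [← Finset.mul_sum, hσ, mul_one]
        rw [eq_sub_iff_add_eq, ← huse, ← Finset.sum_add_distrib]
        exact (Finset.sum_congr rfl fun x _ => by split_ifs <;> simp).trans htot
      by_cases hs : i ∈ s <;> by_cases hi : i ∈ t <;>
        simp [hs, hi, ← Finset.mul_sum, hσ, huse, hnot]
    simp only [hfac]
    rw [Finset.prod_ite_mem, Finset.univ_inter, ← Finset.prod_sdiff ht, mul_comm]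
    congr 1
    · exact Finset.prod_congr rfl fun i hi => if_pos hi
    · exact Finset.prod_congr rfl fun i hi => if_neg (Finset.mem_sdiff.1 hi).2
  have hexp : ∀ (u : N → Bool) (a : N → Finset E),
      h (s.filter fun i => u i ∧ e ∈ a i).card = ∑ t ∈ s.powerset,
        (if s.filter (fun i => u i ∧ e ∈ a i) = t then (1 : ℝ) else 0) * h t.card := by
    intro u a
    simp only [ite_mul, one_mul, zero_mul]
    rw [Finset.sum_ite_eq, if_pos (Finset.mem_powerset.2 (Finset.filter_subset _ _))]
  unfold bexpVal bernExp
  simp only [hexp, Finset.mul_sum, ← mul_assoc]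
  rw [Finset.sum_congr rfl fun u _ => Finset.sum_comm, Finset.sum_comm]
  refine Finset.sum_congr rfl fun t ht => ?_
  rw [← hkey t (Finset.mem_powerset.1 ht), Finset.sum_mul]
  exact Finset.sum_congr rfl fun u _ => (Finset.sum_mul _ _ _).symm

theorem bexpVal_bload (hσ : ∀ i, ∑ a, σ i a = 1) (e : E) :
    bexpVal r σ (fun u a => (bload e u a : ℝ)) = ∑ i, useProb r σ e i := by
  rw [← bernExp_id, ← bexpVal_card_filter hσ]
  simp only [bload, Finset.card_filter]

theorem bexpVal_bloadZ (hσ : ∀ i, ∑ a, σ i a = 1) (i : N) (e : E) (h : ℕ → ℝ) :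
    bexpVal r σ (fun u a => h (bloadZ i e u a)) =
      bernExp (useProb r σ e) (Finset.univ.erase i) h := by
  rw [← bexpVal_card_filter hσ]
  congr! 5 with u a
  rw [bloadZ, ← Finset.card_filter]
  congr 1
  ext j
  simp

end Fintype

theorem useProb_nonneg (hr : ∀ i, 0 < r i ∧ r i < 1) (hσ0 : ∀ i s, 0 ≤ σ i s) (e : E) (i : N) :
    0 ≤ useProb r σ e i :=
  mul_nonneg (hr i).1.le (Finset.sum_nonneg fun s _ => by split_ifs <;> simp [hσ0])

theorem useProb_le (hr : ∀ i, 0 < r i ∧ r i < 1) (hσ0 : ∀ i s, 0 ≤ σ i s)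
    (hσ : ∀ i, ∑ a, σ i a = 1) (e : E) (i : N) : useProb r σ e i ≤ r i := by
  refine mul_le_of_le_one_right (hr i).1.le ?_
  rw [← hσ i]
  exact Finset.sum_le_sum fun s _ => by split_ifs <;> simp [hσ0]

theorem sum_mul_le_of_approx_minimizer {ι : Type*} (S : Finset ι) {y y' w : ι → ℝ} {δ : ℝ}
    (hy : ∀ s ∈ S, 0 ≤ y s) (hy' : ∀ s ∈ S, 0 ≤ y' s) (hsum : ∑ s ∈ S, y s = ∑ s ∈ S, y' s)
    (H : ∀ s ∈ S, 0 < y s → ∀ s' ∈ S, w s ≤ w s' + δ) :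
    ∑ s ∈ S, y s * w s ≤ ∑ s ∈ S, y' s * w s + δ * ∑ s ∈ S, y s := by
  rcases S.eq_empty_or_nonempty with rfl | hS
  · simp
  obtain ⟨m, hm, hmin⟩ := S.exists_min_image w hS
  calc ∑ s ∈ S, y s * w s ≤ ∑ s ∈ S, y s * (w m + δ) := Finset.sum_le_sum fun s hs => by
        rcases (hy s hs).eq_or_lt with h | h
        · simp [← h]
        · exact mul_le_mul_of_nonneg_left (H s hs h m hm) h.le
    _ = ∑ s ∈ S, y' s * w m + δ * ∑ s ∈ S, y s := by
        rw [← Finset.sum_mul, ← Finset.sum_mul, ← hsum]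
        ring
    _ ≤ _ := by
        gcongr with s hs
        · exact hy' s hs
        · exact hmin s hs

theorem IsMixed.sum_eq_one {strat : T → Finset (Finset E)} {tm : N → T}
    (h : IsMixed strat tm σ) (i : N) : ∑ s, σ i s = 1 := by
  rw [← h.2.2 i]
  exact (Finset.sum_subset (Finset.subset_univ _) fun s _ hs => h.2.1 i s hs).symm

section Flow

variable [Fintype T] {strat : T → Finset (Finset E)} {d : T → ℝ} {y y' : T → Finset E → ℝ}
  {x x' : E → ℝ}

theorem Feasible.sum_mul (h : Feasible strat d y x) (w : E → ℝ) :
    ∑ e, w e * x e = ∑ t, ∑ s ∈ strat t, y t s * ∑ e ∈ s, w e := by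
  simp only [h.2.2.2, Finset.mul_sum]
  rw [Finset.sum_comm]
  refine Finset.sum_congr rfl fun t _ => ?_
  rw [Finset.sum_comm]
  refine Finset.sum_congr rfl fun s _ => ?_
  simp only [mul_ite, mul_zero]
  rw [← Finset.sum_filter, Finset.filter_univ_mem]
  exact Finset.sum_congr rfl fun e _ => mul_comm _ _

theorem Feasible.load_mem_Icc (h : Feasible strat d y x) (e : E) :
    x e ∈ Set.Icc 0 (∑ t, d t) := by
  rw [h.2.2.2]
  refine ⟨Finset.sum_nonneg fun t _ => Finset.sum_nonneg fun s _ => ?_,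
    Finset.sum_le_sum fun t _ => ?_⟩
  · split_ifs <;> simp [h.1]
  · rw [h.2.2.1]
    exact Finset.sum_le_sum fun s _ => by split_ifs <;> simp [h.1]

/-- The variational inequality satisfied by an approximate equilibrium flow. -/
theorem Feasible.sum_mul_sub_le (h : Feasible strat d y x) (h' : Feasible strat d y' x')
    {w : E → ℝ} {δ : ℝ}
    (H : ∀ t, ∀ s ∈ strat t, ∀ s' ∈ strat t, 0 < y t s →
      ∑ e ∈ s, w e ≤ ∑ e ∈ s', w e + δ) :
    ∑ e, w e * (x e - x' e) ≤ δ * ∑ t, d t := by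
  simp only [mul_sub, Finset.sum_sub_distrib]
  rw [h.sum_mul, h'.sum_mul, sub_le_iff_le_add', Finset.mul_sum, ← Finset.sum_add_distrib]
  refine Finset.sum_le_sum fun t _ => ?_
  rw [h.2.2.1]
  exact sum_mul_le_of_approx_minimizer _ (fun s _ => h.1 t s) (fun s _ => h'.1 t s)
    ((h.2.2.1 t).symm.trans (h'.2.2.1 t)) fun s hs hy s' hs' => H t s hs s' hs' hy

theorem IsMixed.feasible [Fintype N] {tm : N → T} (h : IsMixed strat tm σ)
    (hr : ∀ i, 0 < r i ∧ r i < 1) :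
    Feasible strat (fun t => ∑ i, if tm i = t then r i else 0)
      (fun t s => ∑ i, if tm i = t then r i * σ i s else 0)
      (fun e => ∑ i, useProb r σ e i) := by
  refine ⟨fun t s => Finset.sum_nonneg fun i _ => ?_, fun t s hs => Finset.sum_eq_zero fun i _ => ?_,
    fun t => ?_, fun e => ?_⟩
  · have := mul_nonneg (hr i).1.le (h.1 i s)
    split_ifs <;> simp [this]
  · split_ifs with hi
    · rw [h.2.1 i s (hi ▸ hs), mul_zero]
    · rfl
  · rw [Finset.sum_comm]
    refine Finset.sum_congr rfl fun i _ => ?_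
    split_ifs with hi
    · rw [← Finset.mul_sum, ← hi, h.2.2, mul_one]
    · simp
  · have : ∀ t s, (if e ∈ s then ∑ i, if tm i = t then r i * σ i s else 0 else 0) =
        ∑ i, if tm i = t then r i * (if e ∈ s then σ i s else 0) else 0 := fun t s => by
      split_ifs <;> simp
    simp only [this]
    rw [Finset.sum_congr rfl fun t _ => Finset.sum_comm, Finset.sum_comm]
    refine Finset.sum_congr rfl fun i _ => ?_
    rw [Finset.sum_eq_single (tm i) (fun t _ ht => by simp [ht.symm]) (by simp)]
    simp only [if_true]
    rw [← Finset.mul_sum, useProb]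
    congr 1
    refine (Finset.sum_subset (Finset.subset_univ _) fun s _ hs => ?_).symm
    rw [h.2.1 i s hs, ite_self]

end Flow

theorem mul_sq_sub_le_of_le_derivWithin {f : ℝ → ℝ} {α β : ℝ} (hβ : 0 < β)
    (hf : ∀ z ∈ Set.Icc (0 : ℝ) α, β ≤ derivWithin f (Set.Icc 0 α) z) {a b : ℝ}
    (ha : a ∈ Set.Icc 0 α) (hb : b ∈ Set.Icc 0 α) :
    β * (a - b) ^ 2 ≤ f a * (a - b) + f b * (b - a) := by
  have hd : DifferentiableOn ℝ f (Set.Icc 0 α) := fun z hz => by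
    by_contra h
    have := hf z hz
    rw [derivWithin_zero_of_not_differentiableWithinAt h] at this
    linarith
  have key := Convex.mul_sub_le_image_sub_of_le_deriv (convex_Icc 0 α) hd.continuousOn
    (hd.mono interior_subset) (C := β) fun z hz => by
      rw [← derivWithin_of_mem_nhds (mem_interior_iff_mem_nhds.1 hz)]
      exact hf z (interior_subset hz)
  rcases le_total a b with h | h
  · nlinarith [mul_le_mul_of_nonneg_right (key a ha b hb h) (sub_nonneg.2 h)]
  · nlinarith [mul_le_mul_of_nonneg_right (key b hb a ha h) (sub_nonneg.2 h)]

end Game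
/-- Non-asymptotic estimate for Bernoulli congestion games: the expected loads `x` of any
Bayes–Nash equilibrium are within `√(2ακ/β) √(Λ(r))` in Euclidean norm of the unique Wardrop
equilibrium loads `x̂` of the nonatomic game with the auxiliary costs `ĉ_e` and the same
expected demands, where `Λ(r) = (αν/2) r e^r / (1-r)² + ζ r`,
`ζ = (e^α - 1) ν + max_e (c_e(2) - c_e(1))`, `r` is the maximal participation probability and
`κ` the cardinality of the largest feasible strategy. -/
theorem stmt17 {E T N : Type*} [Fintype E] [Fintype T] [Fintype N] [Nonempty N] [Nonempty E]
    (strat : T → Finset (Finset E))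
    (hnes : (Finset.univ.biUnion strat : Finset (Finset E)).Nonempty)
    (tm : N → T)
    (c : E → ℕ → ℝ) (hcmono : ∀ e, Monotone (c e)) (hcpos : ∀ e k, 0 ≤ c e k)
    (α β ν : ℝ) (hα : 0 < α) (hβ : 0 < β)
    (hsum : ∀ e, Summable fun k =>
      |c e (k + 3) - 2 * c e (k + 2) + c e (k + 1)| * poiPMF α k)
    (hν : ∀ e, ∑' k : ℕ, |c e (k + 3) - 2 * c e (k + 2) + c e (k + 1)| * poiPMF α k ≤ ν)
    (hderiv : ∀ e, ∀ z ∈ Set.Icc (0 : ℝ) α,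
      β ≤ derivWithin (chat (c e)) (Set.Icc 0 α) z)
    (r : N → ℝ) (hr : ∀ i, 0 < r i ∧ r i < 1)
    (hdtot : ∑ i, r i ≤ α)
    (σ : N → Finset E → ℝ) (hBNE : IsBNE strat c r tm σ)
    (yhat : T → Finset E → ℝ) (xhat : E → ℝ)
    (hWE : IsWE strat (fun e => chat (c e))
      (fun t => ∑ i, if tm i = t then r i else 0) yhat xhat) :
    Real.sqrt (∑ e, (bexpVal r σ (fun u a => (bload e u a : ℝ)) - xhat e) ^ 2) ≤
      Real.sqrt (2 * α *
          ((Finset.univ.biUnion strat).sup' hnes fun s => (s.card : ℝ)) / β) *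
        Real.sqrt (α * ν / 2 *
            ((Finset.univ.sup' Finset.univ_nonempty r) *
                Real.exp (Finset.univ.sup' Finset.univ_nonempty r) /
              (1 - Finset.univ.sup' Finset.univ_nonempty r) ^ 2) +
          ((Real.exp α - 1) * ν +
              Finset.univ.sup' Finset.univ_nonempty (fun e' => c e' 2 - c e' 1)) *
            Finset.univ.sup' Finset.univ_nonempty r) := by
  have hmix := hBNE.1
  have hσ := hmix.sum_eq_one
  simp only [bexpVal_bload hσ]
  set ρ := Finset.univ.sup' Finset.univ_nonempty r with hρ
  set κ := (Finset.univ.biUnion strat).sup' hnes fun s => (s.card : ℝ) with hκ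
  set Δ := Finset.univ.sup' Finset.univ_nonempty (fun e' => c e' 2 - c e' 1) with hΔ
  set x : E → ℝ := fun e => ∑ i, useProb r σ e i with hx
  have hrρ : ∀ i, r i ≤ ρ := fun i => Finset.le_sup' r (Finset.mem_univ i)
  have hρ0 : 0 < ρ := (hr (Classical.arbitrary N)).1.trans_le (hrρ _)
  have hρ1 : ρ < 1 := (Finset.sup'_lt_iff _).2 fun i _ => (hr i).2
  have hκs : ∀ t, ∀ s ∈ strat t, (s.card : ℝ) ≤ κ := fun t s hs =>
    Finset.le_sup' (fun s : Finset E => (s.card : ℝ))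
      (Finset.mem_biUnion.2 ⟨t, Finset.mem_univ t, hs⟩)
  have hκ0 : 0 ≤ κ := by
    obtain ⟨s, hs⟩ := hnes
    exact (Nat.cast_nonneg s.card).trans (Finset.le_sup' (fun s : Finset E => (s.card : ℝ)) hs)
  have hΔe : ∀ e, c e 2 - c e 1 ≤ Δ := fun e =>
    Finset.le_sup' (fun e' => c e' 2 - c e' 1) (Finset.mem_univ e)
  have hΔ0 : 0 ≤ Δ :=
    (sub_nonneg.2 (hcmono (Classical.arbitrary E) one_le_two)).trans (hΔe _)
  have hν0 : 0 ≤ ν := (tsum_nonneg fun k =>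
    mul_nonneg (abs_nonneg _) (poiPMF_nonneg hα.le k)).trans (hν (Classical.arbitrary E))
  have hu0 := useProb_nonneg hr hmix.1
  have huρ : ∀ e i, useProb r σ e i ≤ ρ := fun e i =>
    (useProb_le hr hmix.1 hσ e i).trans (hrρ i)
  have hF := hmix.feasible hr
  have hdr : ∑ t, ∑ i, (if tm i = t then r i else 0) = ∑ i, r i := by
    rw [Finset.sum_comm]
    simp
  have hxI : ∀ e, x e ∈ Set.Icc 0 α := fun e =>
    ⟨(hF.load_mem_Icc e).1, ((hF.load_mem_Icc e).2.trans_eq hdr).trans hdtot⟩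
  have hxhI : ∀ e, xhat e ∈ Set.Icc 0 α := fun e =>
    ⟨(hWE.1.load_mem_Icc e).1, ((hWE.1.load_mem_Icc e).2.trans_eq hdr).trans hdtot⟩
  obtain ⟨U, W, hW, hU, hUW, hb⟩ := exists_excessGap_bounds (N := N) hα hρ0.le hρ1
  set B : N → E → ℝ := fun i e =>
    bernExp (useProb r σ e) (Finset.univ.erase i) (fun n => c e (1 + n)) with hB
  have hedge : ∀ i e, -(W * ν) ≤ chat (c e) (x e) - B i e ∧
      chat (c e) (x e) - B i e ≤ U * ν + ρ * Δ := fun i e => by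
    have h := chat_sub_bernExp_bounds (c := c e) (p := useProb r σ e) (hcmono e) (hsum e) (hν e)
      hU hW (fun j => ⟨hu0 e j, (huρ e j).trans_lt hρ1⟩) (huρ e) (Finset.notMem_erase i Finset.univ)
      (by rw [Finset.insert_erase (Finset.mem_univ i)]; exact (hxI e).2)
      (by
        rw [Finset.insert_erase (Finset.mem_univ i)]
        exact hb _ _ (fun j => ⟨hu0 e j, huρ e j⟩) (hxI e).2)
    rw [Finset.insert_erase (Finset.mem_univ i)] at h
    exact ⟨h.1, h.2.trans (by gcongr; exact hΔe e)⟩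
  set δ := κ * ((U + W) * ν + ρ * Δ) with hδ
  have hδ0 : 0 ≤ δ := by positivity
  have hvar := hF.sum_mul_sub_le hWE.1 (w := fun e => chat (c e) (x e)) (δ := δ) <| by
    intro t s hs s' hs' hy
    obtain ⟨i, -, hi⟩ := Finset.exists_ne_zero_of_sum_ne_zero hy.ne'
    obtain ⟨rfl, hσi⟩ : tm i = t ∧ σ i s ≠ 0 := by
      by_contra! H
      exact hi (by split_ifs with ht <;> simp [H, ht])
    have hne := hBNE.2 i s hs s' hs' ((hmix.1 i s).lt_of_ne' hσi)
    have hcost : ∀ e, bexpVal r σ (fun u a => c e (1 + bloadZ i e u a)) = B i e := fun e =>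
      bexpVal_bloadZ hσ i e fun n => c e (1 + n)
    simp only [hcost] at hne
    have h1 : ∑ e ∈ s, (chat (c e) (x e) - B i e) ≤ κ * (U * ν + ρ * Δ) := by
      refine (Finset.sum_le_card_nsmul s _ _ fun e _ => (hedge i e).2).trans ?_
      rw [nsmul_eq_mul]
      exact mul_le_mul_of_nonneg_right (hκs _ s hs) (by positivity)
    have h2 : ∑ e ∈ s', (B i e - chat (c e) (x e)) ≤ κ * (W * ν) := by
      refine (Finset.sum_le_card_nsmul s' _ (W * ν) fun e _ => by linarith [(hedge i e).1]).trans ?_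
      rw [nsmul_eq_mul]
      exact mul_le_mul_of_nonneg_right (hκs _ s' hs') (by positivity)
    rw [Finset.sum_sub_distrib] at h1 h2
    linear_combination h1 + h2 + hne
  have hvar' := hWE.1.sum_mul_sub_le hF (w := fun e => chat (c e) (xhat e)) (δ := 0)
    fun t s hs s' hs' hy => by simpa using hWE.2 t s hs s' hs' hy
  rw [hdr] at hvar
  have hmain : β * ∑ e, (x e - xhat e) ^ 2 ≤ δ * α := by
    rw [Finset.mul_sum]
    calc ∑ e, β * (x e - xhat e) ^ 2
        ≤ ∑ e, (chat (c e) (x e) * (x e - xhat e) + chat (c e) (xhat e) * (xhat e - x e)) :=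
          Finset.sum_le_sum fun e _ =>
            mul_sq_sub_le_of_le_derivWithin hβ (hderiv e) (hxI e) (hxhI e)
      _ ≤ δ * ∑ i, r i := by
          rw [Finset.sum_add_distrib]
          linarith
      _ ≤ δ * α := by gcongr
  rw [← Real.sqrt_mul (by positivity)]
  refine Real.sqrt_le_sqrt ?_
  rw [div_mul_eq_mul_div, le_div_iff₀ hβ, mul_comm _ β]
  refine hmain.trans ?_
  have h1 := mul_le_mul_of_nonneg_left (mul_le_mul_of_nonneg_right hUW hν0)
    (mul_nonneg hα.le hκ0)
  have h2 : 0 ≤ α * κ * (ρ * Δ) := by positivity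
  rw [hδ]
  linear_combination h1 + h2
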